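/- For the walk with step set S = {(1,0),(0,1),(-1,-1)}, let ξ(x,y) = (x, 1/(xy)), η(x,y) = (1/(xy), y), δ = ηξ, and set f(x,y) = x²y and ψ(x,y) = (y − (xy)²)/z for a nonzero parameter z. Then f∘δ = 1/(xy²), f∘δ² = y/x, ψ∘δ = (x − 1/y²)/z, ψ∘δ² = (1/(xy) − 1/x²)/z, and the algebraicity criterion holds identically: ψ + (ψ∘δ)/(f∘δ) + (ψ∘δ²)/((f∘δ)·(f∘δ²)) = 0 for all x, y, z ≠ 0. -/

import Mathlib

/-- For the walk with step set `S = {(1,0),(0,1),(-1,-1)}` (Kreweras), with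
`ξ(x,y) = (x, 1/(xy))`, `η(x,y) = (1/(xy), y)`, `δ = ηξ` (acting on points as `ξ ∘ η`),
`f(x,y) = x²y` and `ψ(x,y) = (y − (xy)²)/z`, one has `f∘δ = 1/(xy²)`, `f∘δ² = y/x`,
`ψ∘δ = (x − 1/y²)/z`, `ψ∘δ² = (1/(xy) − 1/x²)/z`, and the algebraicity criterion
`ψ + (ψ∘δ)/(f∘δ) + (ψ∘δ²)/((f∘δ)(f∘δ²)) = 0` holds identically. -/
theorem stmt_4 (z : ℂ) (hz : z ≠ 0) (x y : ℂ) (hx : x ≠ 0) (hy : y ≠ 0)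
    (ξ η δ : ℂ × ℂ → ℂ × ℂ) (f ψ : ℂ × ℂ → ℂ)
    (hξ : ∀ p : ℂ × ℂ, ξ p = (p.1, 1 / (p.1 * p.2)))
    (hη : ∀ p : ℂ × ℂ, η p = (1 / (p.1 * p.2), p.2))
    (hδ : ∀ p : ℂ × ℂ, δ p = ξ (η p))
    (hf : ∀ p : ℂ × ℂ, f p = p.1 ^ 2 * p.2)
    (hψ : ∀ p : ℂ × ℂ, ψ p = (p.2 - (p.1 * p.2) ^ 2) / z) :
    f (δ (x, y)) = 1 / (x * y ^ 2) ∧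
    f (δ (δ (x, y))) = y / x ∧
    ψ (δ (x, y)) = (x - 1 / y ^ 2) / z ∧
    ψ (δ (δ (x, y))) = (1 / (x * y) - 1 / x ^ 2) / z ∧
    ψ (x, y) + ψ (δ (x, y)) / f (δ (x, y)) +
        ψ (δ (δ (x, y))) / (f (δ (x, y)) * f (δ (δ (x, y)))) = 0 := by
  have hδ_apply : ∀ a b : ℂ, a ≠ 0 → b ≠ 0 → δ (a, b) = (1 / (a * b), a) := by
    intro a b ha hb
    rw [hδ, hη, hξ]
    ext
    · rfl
    · field_simp
  have hδ₁ : δ (x, y) = (1 / (x * y), x) := hδ_apply x y hx hy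
  have hδ₂ : δ (δ (x, y)) = (y, 1 / (x * y)) := by
    rw [hδ₁, hδ_apply _ _ (one_div_ne_zero (mul_ne_zero hx hy)) hx]
    ext
    · field_simp
    · rfl
  have hf₁ : f (δ (x, y)) = 1 / (x * y ^ 2) := by
    rw [hδ₁, hf]
    field_simp
  have hf₂ : f (δ (δ (x, y))) = y / x := by
    rw [hδ₂, hf]
    field_simp
  have hψ₁ : ψ (δ (x, y)) = (x - 1 / y ^ 2) / z := by
    rw [hδ₁, hψ]
    field_simp
  have hψ₂ : ψ (δ (δ (x, y))) = (1 / (x * y) - 1 / x ^ 2) / z := by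
    rw [hδ₂, hψ]
    field_simp
  refine ⟨hf₁, hf₂, hψ₁, hψ₂, ?_⟩
  rw [hf₁, hf₂, hψ₁, hψ₂, hψ]
  field_simp
  ring
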